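/- Suppose W is a Lipschitz continuous function on the closure of G such that: (i) W(x) = 0 for every x ∈ ∂_oG; (ii) for every x ∈ G and every p ∈ D^+W(x), either H(p) ≥ 0 or there exists i ∈ I(x) with p·γ_i ≥ 0; and (iii) for every x ∈ G \ ∂_cG and every p ∈ D^−W(x), either H(p) ≤ 0 or there exists i ∈ I(x) with p·γ_i ≤ 0. Then W(x) = min_{1≤i≤J} b_i·(z−x) for every x ∈ G; in particular the Lipschitz viscosity solution of the PDE is unique. -/

import Mathlib

open Real

noncomputable section

/-- Euclidean dot product on `ℝ^J`. -/
def dotJ {J : ℕ} (p q : Fin J → ℝ) : ℝ := ∑ j, p j * q j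

/-- `γ_i = e_i − e_{i+1}` for `i < J`, and `γ_J = e_J` (0-indexed). -/
def gam (J : ℕ) (i : Fin J) : Fin J → ℝ :=
  fun j => (if j = i then (1 : ℝ) else 0) - (if (j : ℕ) = (i : ℕ) + 1 then (1 : ℝ) else 0)

/-- `b_i = β_i (e_1 + ⋯ + e_i)` (0-indexed: coordinates `j ≤ i`). -/
def bvec {J : ℕ} (β : Fin J → ℝ) (i : Fin J) : Fin J → ℝ :=
  fun j => if (j : ℕ) ≤ (i : ℕ) then β i else 0

/-- The domain `G`. -/
def domG {J : ℕ} [NeZero J] (z : Fin J → ℝ) : Set (Fin J → ℝ) :=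
  {x | (∀ i, 0 ≤ x i) ∧ x 0 < z 0 ∧ ∀ i : Fin J, i ≠ 0 → x i ≤ z i}

/-- The boundary portion `∂_o G`. -/
def bdO {J : ℕ} [NeZero J] (z : Fin J → ℝ) : Set (Fin J → ℝ) :=
  {x | x 0 = z 0 ∧ ∀ i : Fin J, i ≠ 0 → 0 ≤ x i ∧ x i ≤ z i}

/-- The boundary portion `∂_c G`. -/
def bdC {J : ℕ} [NeZero J] (z : Fin J → ℝ) : Set (Fin J → ℝ) :=
  {x | x ∈ domG z ∧ ∃ i : Fin J, i ≠ 0 ∧ x i = z i}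

/-- The Hamiltonian `H(p) = c + λ(1 − e^{−p_1}) + Σ_i max(0, μ_i(1 − e^{γ_i·p}))`. -/
def Ham {J : ℕ} [NeZero J] (lam c : ℝ) (μ : Fin J → ℝ) (p : Fin J → ℝ) : ℝ :=
  c + lam * (1 - Real.exp (-(p 0))) +
    ∑ i, max 0 (μ i * (1 - Real.exp (dotJ (gam J i) p)))

/-- Superdifferential of `V` at `x`, relative to the set `G`. -/
def supDiff {J : ℕ} (G : Set (Fin J → ℝ)) (V : (Fin J → ℝ) → ℝ) (x : Fin J → ℝ) :
    Set (Fin J → ℝ) :=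
  {p | ∀ ε > 0, ∃ r > 0, ∀ y ∈ G, ‖y - x‖ < r →
    V y - V x - dotJ p (y - x) ≤ ε * ‖y - x‖}

/-- Subdifferential of `V` at `x`, relative to the set `G`. -/
def subDiff {J : ℕ} (G : Set (Fin J → ℝ)) (V : (Fin J → ℝ) → ℝ) (x : Fin J → ℝ) :
    Set (Fin J → ℝ) :=
  {p | ∀ ε > 0, ∃ r > 0, ∀ y ∈ G, ‖y - x‖ < r →
    -(ε * ‖y - x‖) ≤ V y - V x - dotJ p (y - x)}

/-- `A' = {i : μ_i ≤ μ_j for all j < i}`. -/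
def Aprime {J : ℕ} (μ : Fin J → ℝ) : Set (Fin J) := {i | ∀ j, j < i → μ i ≤ μ j}

/-- `A(x) = {i ∈ A' : i+1 ∉ B(x), or every j > i with [i+1,j] ⊆ B(x) has μ_i < μ_j}`. -/
def Aset {J : ℕ} (μ z x : Fin J → ℝ) : Set (Fin J) :=
  {i | i ∈ Aprime μ ∧
    ((∀ h : (i : ℕ) + 1 < J, x ⟨(i : ℕ) + 1, h⟩ ≠ z ⟨(i : ℕ) + 1, h⟩) ∨
      ∀ j : Fin J, i < j → (∀ k : Fin J, i < k → k ≤ j → x k = z k) → μ i < μ j)}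

/-- `l(x) = x log x − x + 1` (finite branch; `Real.log 0 = 0` gives `0·log 0 = 0`). -/
def lfun (x : ℝ) : ℝ := x * Real.log x - x + 1

/-- The control set `U = [0,1]^J`. -/
def Uset (J : ℕ) : Set (Fin J → ℝ) := {u | ∀ i, 0 ≤ u i ∧ u i ≤ 1}

/-- The perturbation set `M = {(λ̄, μ̄) : λ̄ ≥ 0, μ̄_i ≥ 0}`. -/
def Mset (J : ℕ) : Set (ℝ × (Fin J → ℝ)) := {m | 0 ≤ m.1 ∧ ∀ i, 0 ≤ m.2 i}

/-- `H(p,u,m) = c + p·(λ̄ e_1 − Σ_i u_i μ̄_i γ_i) + λ l(λ̄/λ) + Σ_i u_i μ_i l(μ̄_i/μ_i)`. -/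
def Hpum {J : ℕ} [NeZero J] (lam c : ℝ) (μ : Fin J → ℝ) (p u : Fin J → ℝ)
    (m : ℝ × (Fin J → ℝ)) : ℝ :=
  c + dotJ p (fun j => m.1 * (if j = 0 then 1 else 0) - ∑ i, u i * m.2 i * gam J i j)
    + lam * lfun (m.1 / lam) + ∑ i, u i * (μ i * lfun (m.2 i / μ i))

/-- `h(ν,δ) = c + λ(1 − e^{Σ_i ν_i β_i − δ_1}) + Σ_i μ_i(1 − e^{−ν_i β_i + δ_i − δ_{i+1}})`,
with `ν ∈ ℝ^J` and `δ ∈ ℝ^{J+1}`. -/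
def hFun {J : ℕ} (lam c : ℝ) (μ β : Fin J → ℝ)
    (q : (Fin J → ℝ) × (Fin (J + 1) → ℝ)) : ℝ :=
  c + lam * (1 - Real.exp (∑ i, q.1 i * β i - q.2 0)) +
    ∑ i : Fin J, μ i * (1 - Real.exp (-(q.1 i * β i) + q.2 i.castSucc - q.2 i.succ))

/-- The constraint set `S` of pairs `(ν, δ)`. -/
def Sset {J : ℕ} (μ β z x : Fin J → ℝ) :
    Set ((Fin J → ℝ) × (Fin (J + 1) → ℝ)) :=
  {q | q.2 (Fin.last J) = 0 ∧
    (∀ i : Fin J, x i = 0 → 0 ≤ q.2 i.castSucc) ∧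
    (∀ i : Fin J, x i = z i → q.2 i.castSucc ≤ 0) ∧
    (∀ i : Fin J, x i ≠ 0 → x i ≠ z i → q.2 i.castSucc = 0) ∧
    (∀ i ∈ Aset μ z x, 0 ≤ q.1 i) ∧
    (∀ i ∉ Aset μ z x, q.1 i = 0) ∧
    (∑ i, q.1 i) = 1 ∧
    ∀ i : Fin J, -(q.1 i * β i) + q.2 i.castSucc - q.2 i.succ ≤ 0}

/-- `s` = largest (1-indexed) `j ≤ k` with `j ∉ I(x)`, and `s = 0` if none exists. -/
def sIdx {J : ℕ} (x : Fin J → ℝ) (k : Fin J) : ℕ :=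
  sSup (insert 0 ((fun j : Fin J => (j : ℕ) + 1) '' {j | j ≤ k ∧ x j ≠ 0}))

/-- `t` = least (1-indexed) `j ∈ [k+1, J]` with `j ∉ B(x)`, and `t = J+1` if none exists. -/
def tIdx {J : ℕ} (z x : Fin J → ℝ) (k : Fin J) : ℕ :=
  sInf (insert (J + 1) ((fun j : Fin J => (j : ℕ) + 1) '' {j | k < j ∧ x j ≠ z j}))

/-- `δ^{(r,k)}_i = β_k (1_{i ≥ r+1} − 1_{i ≥ k+1})` (1-indexed `i`, `r`; coordinates of
`Fin (J+1)` are the 1-indexed positions shifted by one). -/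
def delrk {J : ℕ} (β : Fin J → ℝ) (k : Fin J) (r : ℕ) : Fin (J + 1) → ℝ :=
  fun i => β k * ((if r ≤ (i : ℕ) then 1 else 0) - (if (k : ℕ) + 1 ≤ (i : ℕ) then 1 else 0))

open Filter Topology

/-- Partial sums. -/
def psum {J : ℕ} (x : Fin J → ℝ) (n : ℕ) : ℝ := ∑ i : Fin J, if (i : ℕ) < n then x i else 0

lemma psum_zero {J : ℕ} (x : Fin J → ℝ) : psum x 0 = 0 := by simp [psum]

lemma psum_succ {J : ℕ} (x : Fin J → ℝ) (l : Fin J) :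
    psum x ((l : ℕ) + 1) = psum x l + x l := by
  have : x l = ∑ i : Fin J, if i = l then x i else 0 := by simp
  rw [this]
  unfold psum
  rw [← Finset.sum_add_distrib]
  refine Finset.sum_congr rfl fun i _ => ?_
  by_cases h1 : i = l
  · subst h1; simp
  · have h2 : (i : ℕ) ≠ l := fun h => h1 (Fin.ext h)
    by_cases h3 : (i : ℕ) < l
    · simp [h1, h3, Nat.lt_succ_of_lt h3]
    · have : ¬ ((i : ℕ) < l + 1) := by omega
      simp [h1, h3, this]

lemma psum_mono {J : ℕ} {x : Fin J → ℝ} (hx : ∀ i, 0 ≤ x i) {m n : ℕ} (h : m ≤ n) :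
    psum x m ≤ psum x n := by
  refine Finset.sum_le_sum fun i _ => ?_
  have := hx i
  split_ifs <;> first | omega | linarith

lemma psum_diff_mono {J : ℕ} {x z : Fin J → ℝ} (hx : ∀ i, x i ≤ z i) {m n : ℕ} (h : m ≤ n) :
    psum z m - psum x m ≤ psum z n - psum x n := by
  have e : ∀ k, psum z k - psum x k = psum (z - x) k := by
    intro k; unfold psum; rw [← Finset.sum_sub_distrib]
    refine Finset.sum_congr rfl fun i _ => ?_
    split_ifs <;> simp
  rw [e, e]
  exact psum_mono (fun i => by simp [hx i]) h

lemma psum_one {J : ℕ} [NeZero J] (x : Fin J → ℝ) : psum x 1 = x 0 := by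
  have := psum_succ x 0
  simpa [psum_zero] using this

lemma psum_le_total {J : ℕ} {x : Fin J → ℝ} (hx : ∀ i, 0 ≤ x i) (n : ℕ) :
    psum x n ≤ psum x J := by
  refine Finset.sum_le_sum fun i _ => ?_
  have := hx i
  have := i.2
  split_ifs <;> first | omega | linarith

lemma psum_le {J : ℕ} {x z : Fin J → ℝ} (hx : ∀ i, x i ≤ z i) (n : ℕ) :
    psum x n ≤ psum z n := by
  have := psum_diff_mono hx (Nat.zero_le n)
  simp only [psum_zero] at this
  linarith

lemma dotJ_comm {J : ℕ} (p q : Fin J → ℝ) : dotJ p q = dotJ q p := by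
  simp [dotJ, mul_comm]

lemma dot_bvec {J : ℕ} (β x z : Fin J → ℝ) (k : Fin J) :
    dotJ (bvec β k) (z - x) = β k * (psum z ((k : ℕ) + 1) - psum x ((k : ℕ) + 1)) := by
  unfold dotJ psum bvec
  rw [← Finset.sum_sub_distrib, Finset.mul_sum]
  refine Finset.sum_congr rfl fun i _ => ?_
  simp only [Nat.lt_succ_iff, Pi.sub_apply]
  split_ifs <;> simp

lemma dot_gam {J : ℕ} (P : ℕ → ℝ) (hP : P J = 0) (l : Fin J) :
    dotJ (gam J l) (fun i => P i) = P l - P (l + 1) := by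
  unfold dotJ gam
  simp only [sub_mul, Finset.sum_sub_distrib]
  congr 1
  · simp
  · by_cases h : (l : ℕ) + 1 < J
    · rw [Finset.sum_eq_single ⟨(l : ℕ) + 1, h⟩]
      · simp
      · intro b _ hb
        have : (b : ℕ) ≠ l + 1 := fun h' => hb (Fin.ext h')
        simp [this]
      · simp
    · have e : (l : ℕ) + 1 = J := by have := l.2; omega
      rw [e, hP]
      refine Finset.sum_eq_zero fun b _ => ?_
      have : (b : ℕ) ≠ J := b.2.ne
      simp [this]

lemma exp_conv (t y : ℝ) (h0 : 0 ≤ t) (h1 : t ≤ 1) :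
    Real.exp (t * y) ≤ (1 - t) + t * Real.exp y := by
  have := convexOn_exp.2 (Set.mem_univ 0) (Set.mem_univ y) (by linarith : 0 ≤ 1 - t) h0 (by ring)
  simpa using this

lemma exp_jensen {ι : Type*} [Fintype ι] (ν y : ι → ℝ) (h0 : ∀ a, 0 ≤ ν a) (h1 : ∑ a, ν a = 1) :
    Real.exp (∑ a, ν a * y a) ≤ ∑ a, ν a * Real.exp (y a) := by
  have := convexOn_exp.map_sum_le (t := Finset.univ) (w := ν) (p := y) (fun i _ => h0 i) h1
    (fun i _ => Set.mem_univ _)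
  simpa using this

/-- lower bound below the root -/
lemma f_low (lam c m β b δ : ℝ) (hlam : 0 < lam) (hc : 0 < c) (hm : 0 < m) (hβ : 0 < β)
    (hb0 : 0 ≤ b) (hb : b ≤ (1 - δ) * β) (hδ : 0 ≤ δ)
    (he : c + lam * (1 - Real.exp β) + m * (1 - Real.exp (-β)) = 0) :
    δ * c ≤ c + lam * (1 - Real.exp b) + m * (1 - Real.exp (-b)) := by
  have ht : b / β ≤ 1 - δ := by rw [div_le_iff₀ hβ]; exact hb
  have ht0 : 0 ≤ b / β := by positivity
  set t := b / β with htd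
  have e : b = t * β := by rw [htd]; field_simp
  have h1 := exp_conv t β ht0 (by linarith)
  have h2 := exp_conv t (-β) ht0 (by linarith)
  rw [← e] at h1
  rw [mul_neg, ← e] at h2
  have h3 := mul_le_mul_of_nonneg_left h1 hlam.le
  have h4 := mul_le_mul_of_nonneg_left h2 hm.le
  have h5 : t * (c + lam * (1 - Real.exp β) + m * (1 - Real.exp (-β))) = 0 := by rw [he]; ring
  nlinarith

lemma f_up (lam c m β δ : ℝ) (hlam : 0 < lam) (hm : 0 < m) (hδ : 0 < δ)
    (he : c + lam * (1 - Real.exp β) + m * (1 - Real.exp (-β)) = 0) :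
    c + lam * (1 - Real.exp ((1 + δ) * β)) + m * (1 - Real.exp (-((1 + δ) * β))) ≤ - (δ * c) := by
  set t := 1 / (1 + δ) with htd
  have ht0 : 0 ≤ t := by positivity
  have ht1 : t ≤ 1 := by rw [htd, div_le_one (by linarith)]; linarith
  have e : t * ((1 + δ) * β) = β := by rw [htd]; field_simp
  have h1 := exp_conv t ((1 + δ) * β) ht0 ht1
  have h2 := exp_conv t (-((1 + δ) * β)) ht0 ht1
  rw [e] at h1
  rw [mul_neg, e] at h2
  have h3 := mul_le_mul_of_nonneg_left h1 hlam.le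
  have h4 := mul_le_mul_of_nonneg_left h2 hm.le
  have h6 : (1 + δ) * t = 1 := by rw [htd]; field_simp
  have h7 : 0 ≤ -((1 - t) * c + t * (c + lam * (1 - Real.exp ((1 + δ) * β)) +
     m * (1 - Real.exp (-((1 + δ) * β))))) := by nlinarith
  have h8 := mul_nonneg (by linarith : 0 ≤ 1 + δ) h7
  have h9 : (1 + δ) * -((1 - t) * c + t * (c + lam * (1 - Real.exp ((1 + δ) * β)) +
     m * (1 - Real.exp (-((1 + δ) * β))))) = - ((1 + δ) - (1 + δ) * t) * c - ((1 + δ) * t) *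
     (c + lam * (1 - Real.exp ((1 + δ) * β)) + m * (1 - Real.exp (-((1 + δ) * β)))) := by ring
  rw [h9, h6] at h8
  linarith

lemma ham_pos {J : ℕ} [NeZero J] (lam c : ℝ) (μ : Fin J → ℝ) {ι : Type*} [Fintype ι]
    (hlam : 0 < lam) (hμ : ∀ i, 0 < μ i)
    (j : ι → ℕ) (hj : ∀ a, j a ≤ J) (b ν : ι → ℝ) (hb0 : ∀ a, 0 ≤ b a) (hν0 : ∀ a, 0 ≤ ν a) (hν1 : ∑ a, ν a = 1)
    (θ : ℕ → ℝ) (hθ : ∀ n, 0 ≤ θ n) (hθ0 : θ 0 = 0) (hθJ : θ J = 0) (η δ : ℝ)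
    (hη : 0 < η) (hη1 : η ≤ 1)
    (hf : ∀ a, δ * c ≤ c + lam * (1 - Real.exp (if 0 < j a then b a else 0)) +
      ∑ l : Fin J, μ l * (1 - Real.exp (-(if j a = l + 1 then b a else 0))))
    (hs : ∀ l : Fin J, 0 < θ (l + 1) → ∑ a, ν a * (if j a = l + 1 then b a else 0) ≤ η / 2)
    (hμη : 3 * η * ∑ l, μ l < δ * c)
    (P : ℕ → ℝ)
    (hP : ∀ n, P n = - ∑ a, ν a * (if n < j a then b a else 0) - θ n + η * (J - n)) :
    P J = 0 ∧ (∀ l : Fin J, P l - P (l + 1) =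
      - (∑ a, ν a * (if j a = l + 1 then b a else 0)) - θ l + θ (l + 1) + η) ∧
    0 < Ham lam c μ (fun i => P i) := by
  have hPJ : P J = 0 := by
    rw [hP, hθJ]
    have : ∑ a, ν a * (if J < j a then b a else 0) = 0 := by
      refine Finset.sum_eq_zero fun a _ => ?_
      have := hj a
      rw [if_neg (by omega)]; simp
    rw [this]; simp
  have hd : ∀ l : Fin J, P l - P (l + 1) =
      - (∑ a, ν a * (if j a = l + 1 then b a else 0)) - θ l + θ (l + 1) + η := by
    intro l
    have : ∑ a, ν a * (if (l : ℕ) < j a then b a else 0) =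
        ∑ a, ν a * (if (l : ℕ) + 1 < j a then b a else 0) +
        ∑ a, ν a * (if j a = l + 1 then b a else 0) := by
      rw [← Finset.sum_add_distrib]
      refine Finset.sum_congr rfl fun a _ => ?_
      split_ifs <;> first | omega | ring
    rw [hP, hP, this]
    push_cast
    ring
  refine ⟨hPJ, hd, ?_⟩
  unfold Ham
  have h0 : Real.exp (-(P ((0 : Fin J) : ℕ))) ≤
      ∑ a, ν a * Real.exp (if 0 < j a then b a else 0) := by
    refine le_trans ?_ (exp_jensen ν _ hν0 hν1)
    apply Real.exp_le_exp.2
    rw [Fin.val_zero, hP, hθ0]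
    have : 0 ≤ η * (J : ℝ) := by positivity
    simp only [Nat.cast_zero, sub_zero]
    linarith
  have h1 : ∀ l : Fin J, μ l * (∑ a, ν a * (1 - Real.exp (-(if j a = l + 1 then b a else 0))))
      - 3 * η * μ l ≤ max 0 (μ l * (1 - Real.exp (dotJ (gam J l) (fun i => P i)))) := by
    intro l
    rw [dot_gam P hPJ, hd]
    set s := ∑ a, ν a * (if j a = l + 1 then b a else 0) with hsd
    have hJ : ∑ a, ν a * (1 - Real.exp (-(if j a = l + 1 then b a else 0))) ≤
        1 - Real.exp (-s) := by
      have := exp_jensen ν (fun a => -(if j a = l + 1 then b a else 0)) hν0 hν1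
      have e : ∑ a, ν a * -(if j a = l + 1 then b a else 0) = -s := by
        rw [hsd, ← Finset.sum_neg_distrib]; simp
      rw [e] at this
      simp only [mul_sub, mul_one, Finset.sum_sub_distrib, hν1]
      linarith
    have hm := hμ l
    rcases (hθ (l + 1)).eq_or_lt with h | h
    · refine le_trans ?_ (le_max_right _ _)
      rw [← h]
      have e1 : Real.exp (-s - θ l + 0 + η) ≤ Real.exp (-s + η) := by
        apply Real.exp_le_exp.2; have := hθ l; linarith
      have hs0 : 0 ≤ s := Finset.sum_nonneg fun a _ => mul_nonneg (hν0 a) (by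
        have := hb0 a
        split_ifs <;> simp [this])
      · have e2 : Real.exp (-s + η) ≤ Real.exp (-s) + 3 * η := by
          rw [Real.exp_add]
          have e3 : Real.exp (-s) ≤ 1 := Real.exp_le_one_iff.2 (by linarith)
          have e4 := Real.abs_exp_sub_one_le (x := η) (by rw [abs_of_pos hη]; exact hη1)
          rw [abs_of_pos hη] at e4
          have e5 := (abs_le.1 e4).2
          have := Real.exp_pos (-s)
          nlinarith
        nlinarith
    · refine le_trans ?_ (le_max_left _ _)
      have := hs l h
      have e6 := Real.add_one_le_exp (-s)
      nlinarith
  have h2 := Finset.sum_le_sum fun l (_ : l ∈ Finset.univ) => h1 l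
  have h3 : ∑ a, ν a * (δ * c) ≤ ∑ a, ν a * (c + lam * (1 - Real.exp (if 0 < j a then b a else 0)) +
      ∑ l : Fin J, μ l * (1 - Real.exp (-(if j a = l + 1 then b a else 0)))) :=
    Finset.sum_le_sum fun a _ => mul_le_mul_of_nonneg_left (hf a) (hν0 a)
  have h4 : ∑ a, ν a * (c + lam * (1 - Real.exp (if 0 < j a then b a else 0)) +
      ∑ l : Fin J, μ l * (1 - Real.exp (-(if j a = l + 1 then b a else 0)))) =
      c + lam * (1 - ∑ a, ν a * Real.exp (if 0 < j a then b a else 0)) +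
      ∑ l : Fin J, μ l * (∑ a, ν a * (1 - Real.exp (-(if j a = l + 1 then b a else 0)))) := by
    have e1 : ∑ a, ν a * (∑ l : Fin J, μ l * (1 - Real.exp (-(if j a = l + 1 then b a else 0))))
        = ∑ l : Fin J, μ l * (∑ a, ν a *
          (1 - Real.exp (-(if j a = l + 1 then b a else 0)))) := by
      simp only [Finset.mul_sum]
      rw [Finset.sum_comm]
      refine Finset.sum_congr rfl fun l _ => Finset.sum_congr rfl fun a _ => by ring
    have e2 : ∑ a, ν a * (lam * (1 - Real.exp (if 0 < j a then b a else 0))) =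
        lam * (∑ a, ν a - ∑ a, ν a * Real.exp (if 0 < j a then b a else 0)) := by
      rw [← Finset.sum_sub_distrib, Finset.mul_sum]
      refine Finset.sum_congr rfl fun a _ => by ring
    simp only [mul_add, Finset.sum_add_distrib]
    rw [e1, e2, ← Finset.sum_mul, hν1, one_mul]
  rw [h4, ← Finset.sum_mul, hν1, one_mul] at h3
  rw [Finset.sum_sub_distrib, ← Finset.mul_sum] at h2
  have h5 := mul_le_mul_of_nonneg_left h0 hlam.le
  nlinarith

lemma hasDerivAt_pos_sq (t : ℝ) : HasDerivAt (fun t : ℝ => (max 0 t) ^ 2) (2 * max 0 t) t := by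
  rw [hasDerivAt_iff_isLittleO_nhds_zero]
  have h2 : (fun h : ℝ => h ^ 2) =o[𝓝 0] fun h => h := by
    simpa using Asymptotics.isLittleO_pow_id (𝕜 := ℝ) (n := 2) (by norm_num)
  refine Asymptotics.IsBigO.trans_isLittleO ?_ h2
  refine Asymptotics.IsBigO.of_bound 1 (Filter.Eventually.of_forall fun h => ?_)
  rw [one_mul, Real.norm_eq_abs, Real.norm_eq_abs, abs_of_nonneg (sq_nonneg h), abs_le, smul_eq_mul]
  rcases le_total 0 t with ht | ht <;> rcases le_total 0 (t + h) with h' | h' <;>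
    simp only [max_eq_right, max_eq_left, ht, h'] <;> constructor <;> nlinarith

/-- The dot product as a continuous linear map. -/
def dotL {J : ℕ} (p : Fin J → ℝ) : (Fin J → ℝ) →L[ℝ] ℝ :=
  ∑ i, p i • ContinuousLinearMap.proj (R := ℝ) (φ := fun _ : Fin J => ℝ) i

lemma dotL_apply {J : ℕ} (p v : Fin J → ℝ) : dotL p v = dotJ p v := by
  simp [dotL, dotJ]

lemma hasFDerivAt_psum {J : ℕ} (n : ℕ) (x : Fin J → ℝ) :
    HasFDerivAt (fun y => psum y n) (dotL (fun i : Fin J => if (i : ℕ) < n then (1 : ℝ) else 0)) x := by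
  have : (fun y : Fin J → ℝ => psum y n) =
      dotL (fun i : Fin J => if (i : ℕ) < n then (1 : ℝ) else 0) := by
    funext y; rw [dotL_apply]; simp [psum, dotJ]
  rw [this]
  exact ContinuousLinearMap.hasFDerivAt _

lemma sub_of_min {J : ℕ} (G : Set (Fin J → ℝ)) (W φ : (Fin J → ℝ) → ℝ) (x p : Fin J → ℝ)
    (hd : HasFDerivAt φ (dotL p) x) (hm : ∀ y ∈ G, W x - φ x ≤ W y - φ y) :
    p ∈ subDiff G W x := by
  intro ε hε
  rw [hasFDerivAt_iff_isLittleO] at hd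
  have := hd.def hε
  rw [Metric.eventually_nhds_iff] at this
  obtain ⟨r, hr, h⟩ := this
  refine ⟨r, hr, fun y hy hyr => ?_⟩
  have h1 := h (y := y) (by rwa [dist_eq_norm])
  rw [dotL_apply, Real.norm_eq_abs, abs_le] at h1
  have := hm y hy
  linarith [h1.1]

lemma sup_of_max {J : ℕ} (G : Set (Fin J → ℝ)) (W φ : (Fin J → ℝ) → ℝ) (x p : Fin J → ℝ)
    (hd : HasFDerivAt φ (dotL p) x) (hm : ∀ y ∈ G, W y - φ y ≤ W x - φ x) :
    p ∈ supDiff G W x := by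
  intro ε hε
  rw [hasFDerivAt_iff_isLittleO] at hd
  have := hd.def hε
  rw [Metric.eventually_nhds_iff] at this
  obtain ⟨r, hr, h⟩ := this
  refine ⟨r, hr, fun y hy hyr => ?_⟩
  have h1 := h (y := y) (by rwa [dist_eq_norm])
  rw [dotL_apply, Real.norm_eq_abs, abs_le] at h1
  have := hm y hy
  linarith [h1.2]

lemma box_mem {J : ℕ} [NeZero J] {z x : Fin J → ℝ} (hx : x ∈ Set.Icc 0 z) :
    x ∈ domG z ∨ x ∈ bdO z := by
  rcases (hx.2 0).eq_or_lt with h | h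
  · right; exact ⟨h, fun i _ => ⟨hx.1 i, hx.2 i⟩⟩
  · left; exact ⟨hx.1, h, fun i _ => hx.2 i⟩

lemma dom_box {J : ℕ} [NeZero J] {z x : Fin J → ℝ} (hx : x ∈ domG z) : x ∈ Set.Icc 0 z := by
  refine ⟨hx.1, fun i => ?_⟩
  by_cases h : i = 0
  · subst h; exact hx.2.1.le
  · exact hx.2.2 i h

lemma box_closure {J : ℕ} [NeZero J] {z : Fin J → ℝ} (hz : ∀ i, 0 < z i) :
    Set.Icc 0 z ⊆ closure (domG z) := by
  intro x hx
  have ht : Tendsto (fun t : ℝ => (1 - t) • x) (𝓝[>] 0) (𝓝 x) := by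
    have : Tendsto (fun t : ℝ => (1 - t) • x) (𝓝 0) (𝓝 ((1 - (0 : ℝ)) • x)) := by
      apply Continuous.tendsto
      fun_prop
    simp only [sub_zero, one_smul] at this
    exact this.mono_left nhdsWithin_le_nhds
  refine mem_closure_of_tendsto ht ?_
  have h1 : ∀ᶠ t : ℝ in 𝓝[>] 0, t < 1 := nhdsWithin_le_nhds (gt_mem_nhds one_pos)
  filter_upwards [h1, self_mem_nhdsWithin] with t ht1 ht0
  have ht0' : 0 < t := ht0
  have hx1 := hx.1
  have hx2 := hx.2
  refine ⟨fun i => ?_, ?_, fun i _ => ?_⟩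
  · have := hx1 i; simp only [Pi.smul_apply, smul_eq_mul]
    exact mul_nonneg (by linarith) this
  · have h3 := hx1 0; have h4 := hx2 0; have := hz 0
    simp only [Pi.smul_apply, smul_eq_mul, Pi.zero_apply] at *
    rcases h3.eq_or_lt with h | h
    · rw [← h]; simpa using this
    · nlinarith
  · have h3 := hx1 i; have h4 := hx2 i
    simp only [Pi.smul_apply, smul_eq_mul, Pi.zero_apply] at *
    nlinarith

lemma small_ev (A B : ℝ) (hB : 0 < B) : ∀ᶠ ε : ℝ in 𝓝[>] 0, ε * A ≤ B := by
  have : Tendsto (fun t : ℝ => t * A) (𝓝 0) (𝓝 (0 * A)) := by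
    apply Continuous.tendsto
    fun_prop
  rw [zero_mul] at this
  exact nhdsWithin_le_nhds ((this.eventually (gt_mem_nhds hB)).mono fun _ h => le_of_lt h)

lemma pos_ev : ∀ᶠ ε : ℝ in 𝓝[>] 0, 0 < ε := self_mem_nhdsWithin

/-- Upper bound. -/
lemma upper_bound {J : ℕ} [NeZero J] (lam c : ℝ) (μ z β : Fin J → ℝ)
    (hlam : 0 < lam) (hc : 0 < c) (hμ : ∀ i, 0 < μ i) (hz : ∀ i, 0 < z i)
    (hβ : ∀ i, 0 < β i ∧
      c + lam * (1 - Real.exp (β i)) + μ i * (1 - Real.exp (-(β i))) = 0)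
    (W : (Fin J → ℝ) → ℝ)
    (hcont : ContinuousOn W (Set.Icc 0 z))
    (hbd : ∀ x ∈ bdO z, W x = 0)
    (hsup : ∀ x ∈ domG z, ∀ p ∈ supDiff (domG z) W x,
      0 ≤ Ham lam c μ p ∨ ∃ i : Fin J, x i = 0 ∧ 0 ≤ dotJ p (gam J i))
    (x₀ : Fin J → ℝ) (hx₀ : x₀ ∈ domG z) (k : Fin J) :
    W x₀ ≤ β k * (psum z ((k : ℕ) + 1) - psum x₀ ((k : ℕ) + 1)) := by
  by_contra! hcon
  set Q := β k * (psum z ((k : ℕ) + 1) - psum x₀ ((k : ℕ) + 1)) with hQ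
  obtain ⟨δ, hδ1, hδ⟩ := ((small_ev Q ((W x₀ - Q) / 4) (by linarith)).and pos_ev).exists
  set w : Fin J → ℝ := fun i => ((J : ℝ) - (i : ℕ)) with hw
  obtain ⟨ε, ⟨hε1, hε2⟩, hε⟩ := (((small_ev (dotJ w (z - x₀)) ((W x₀ - Q) / 4) (by linarith)).and
    (small_ev (2 * ∑ l, μ l) (δ * c / 2) (by positivity))).and pos_ev).exists
  set P : ℕ → ℝ := fun n => - ((1 + δ) * (if n ≤ k then β k else 0)) - ε * ((J : ℝ) - n) with hP
  set p : Fin J → ℝ := fun i => P i with hp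
  have hPJ : P J = 0 := by
    have : ¬ (J ≤ (k : ℕ)) := by have := k.2; omega
    simp [hP, this]
  have hPd : ∀ l : Fin J, P l - P (l + 1) = - ((1 + δ) * (if l = k then β k else 0)) - ε := by
    intro l
    simp only [hP]
    by_cases h1 : l = k
    · subst h1; simp; ring
    · have h2 : (l : ℕ) ≠ k := fun h => h1 (Fin.ext h)
      rcases lt_or_gt_of_ne h2 with h3 | h3
      · rw [if_pos h3.le, if_pos (by omega), if_neg h1]; push_cast; ring
      · rw [if_neg (by omega), if_neg (by omega), if_neg h1]; push_cast; ring
  have hdotp : ∀ x : Fin J → ℝ, dotJ p (x - z) =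
      (1 + δ) * (β k * (psum z ((k : ℕ) + 1) - psum x ((k : ℕ) + 1))) + ε * dotJ w (z - x) := by
    intro x
    rw [← dot_bvec]
    simp only [dotJ, Finset.mul_sum]
    rw [← Finset.sum_add_distrib]
    refine Finset.sum_congr rfl fun i _ => ?_
    simp only [hp, hP, hw, bvec, Pi.sub_apply]
    split_ifs <;> ring
  set φ : (Fin J → ℝ) → ℝ := fun x => dotJ p (x - z) with hφ
  have hφd : ∀ x, HasFDerivAt φ (dotL p) x := by
    intro x
    have : φ = fun x => dotL p (x - z) := by funext x; rw [dotL_apply]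
    rw [this]
    have h := (dotL p).hasFDerivAt.comp x ((hasFDerivAt_id x).sub_const z)
    rw [ContinuousLinearMap.comp_id] at h
    exact h
  have hφc : Continuous φ := continuous_iff_continuousAt.2 fun x => (hφd x).continuousAt
  obtain ⟨x, hxB, hmax⟩ := isCompact_Icc.exists_isMaxOn ⟨x₀, dom_box hx₀⟩
    (hcont.sub hφc.continuousOn)
  have hmax' : ∀ y ∈ Set.Icc 0 z, W y - φ y ≤ W x - φ x := fun y hy => hmax hy
  have hx0 : 0 < W x - φ x := by
    refine lt_of_lt_of_le ?_ (hmax' x₀ (dom_box hx₀))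
    simp only [hφ]
    rw [hdotp, ← hQ]
    nlinarith
  have hwn : 0 ≤ dotJ w (z - x) := Finset.sum_nonneg fun i _ => by
    refine mul_nonneg ?_ (by simpa using hxB.2 i)
    have : ((i : ℕ) : ℝ) ≤ J := by exact_mod_cast i.2.le
    simp only [hw]; linarith
  have hxG : x ∈ domG z := by
    rcases box_mem hxB with h | h
    · exact h
    · exfalso
      rw [hbd x h] at hx0
      have : 0 ≤ φ x := by
        simp only [hφ]
        rw [hdotp]
        have h1 := psum_le hxB.2 (k + 1)
        have := (hβ k).1
        have h2 : 0 ≤ psum z (k + 1) - psum x (k + 1) := by linarith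
        positivity
      linarith
  have hps : p ∈ supDiff (domG z) W x :=
    sup_of_max _ W φ x p (hφd x) fun y hy => hmax' y (dom_box hy)
  have hgn : ∀ l, dotJ (gam J l) p < 0 := by
    intro l
    rw [hp, dot_gam P hPJ, hPd]
    have := (hβ k).1
    split_ifs
    · have : 0 < (1 + δ) * β k := by positivity
      linarith
    · linarith
  rcases hsup x hxG p hps with h | ⟨i, -, h⟩
  · unfold Ham at h
    have h0 : Real.exp ((1 + δ) * β k) ≤ Real.exp (-(p 0)) := by
      apply Real.exp_le_exp.2
      simp only [hp, hP, Fin.val_zero]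
      have : 0 ≤ ε * (J : ℝ) := by positivity
      simp
      linarith
    have h1 : ∀ l : Fin J, max 0 (μ l * (1 - Real.exp (dotJ (gam J l) p))) ≤
        (if l = k then μ k * (1 - Real.exp (-((1 + δ) * β k))) else 0) + 2 * ε * μ l := by
      intro l
      have hm := hμ l
      have hle : 0 ≤ 1 - Real.exp (dotJ (gam J l) p) := by
        have := Real.exp_le_one_iff.2 (hgn l).le; linarith
      rw [max_eq_right (by positivity), hp, dot_gam P hPJ, hPd]
      have e1 := Real.add_one_le_exp (-ε)
      split_ifs with hl
      · subst hl
        rw [sub_eq_add_neg (-((1 + δ) * β l)) ε, Real.exp_add]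
        have e2 : Real.exp (-((1 + δ) * β l)) ≤ 1 := Real.exp_le_one_iff.2 (by
          have := (hβ l).1
          have : 0 < (1 + δ) * β l := by positivity
          linarith)
        have e3 := Real.exp_pos (-((1 + δ) * β l))
        have e4 : Real.exp (-((1 + δ) * β l)) - Real.exp (-((1 + δ) * β l)) * Real.exp (-ε) ≤
          2 * ε := by nlinarith
        nlinarith
      · have : Real.exp (-((1 + δ) * 0) - ε) = Real.exp (-ε) := by congr 1; ring
        rw [this]
        nlinarith
    have h2 := Finset.sum_le_sum fun l (_ : l ∈ Finset.univ) => h1 l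
    rw [Finset.sum_add_distrib, ← Finset.mul_sum] at h2
    simp only [Finset.sum_ite_eq', Finset.mem_univ, if_true] at h2
    have h3 := f_up lam c (μ k) (β k) δ hlam (hμ k) hδ (hβ k).2
    have h5 := mul_le_mul_of_nonneg_left h0 hlam.le
    have : 0 < δ * c := by positivity
    nlinarith
  · rw [dotJ_comm] at h
    linarith [hgn i]

/-- soft minimum of affine functions -/
def softF {J : ℕ} {ι : Type*} [Fintype ι] (j : ι → ℕ) (b D : ι → ℝ) (τ : ℝ) (x : Fin J → ℝ) : ℝ :=
  -τ * Real.log (∑ a, Real.exp (-(b a * (D a - psum x (j a))) / τ))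

/-- soft minimum weights -/
def softW {J : ℕ} {ι : Type*} [Fintype ι] (j : ι → ℕ) (b D : ι → ℝ) (τ : ℝ) (x : Fin J → ℝ)
    (a : ι) : ℝ :=
  Real.exp (-(b a * (D a - psum x (j a))) / τ) /
    ∑ a, Real.exp (-(b a * (D a - psum x (j a))) / τ)

section soft
variable {J : ℕ} {ι : Type*} [Fintype ι] [Nonempty ι] (j : ι → ℕ) (b D : ι → ℝ) (τ : ℝ)
  (x : Fin J → ℝ)

lemma soft_sum_pos : 0 < ∑ a, Real.exp (-(b a * (D a - psum x (j a))) / τ) :=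
  Finset.sum_pos (fun _ _ => Real.exp_pos _) Finset.univ_nonempty

lemma softW_nonneg (a : ι) : 0 ≤ softW j b D τ x a :=
  div_nonneg (Real.exp_pos _).le (soft_sum_pos j b D τ x).le

lemma softW_sum : ∑ a, softW j b D τ x a = 1 := by
  unfold softW
  rw [← Finset.sum_div, div_self (soft_sum_pos j b D τ x).ne']

lemma softF_le (hτ : 0 < τ) (a : ι) : softF j b D τ x ≤ b a * (D a - psum x (j a)) := by
  unfold softF
  have h1 : Real.exp (-(b a * (D a - psum x (j a))) / τ) ≤
      ∑ a, Real.exp (-(b a * (D a - psum x (j a))) / τ) :=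
    Finset.single_le_sum (f := fun a => Real.exp (-(b a * (D a - psum x (j a))) / τ))
      (fun _ _ => (Real.exp_pos _).le) (Finset.mem_univ a)
  have h2 := Real.log_le_log (Real.exp_pos _) h1
  rw [Real.log_exp, div_le_iff₀ hτ] at h2
  linarith

lemma le_softF (hτ : 0 < τ) (m : ℝ) (hm : ∀ a, m ≤ b a * (D a - psum x (j a))) :
    m - τ * Real.log (Fintype.card ι) ≤ softF j b D τ x := by
  unfold softF
  have h1 : ∑ a, Real.exp (-(b a * (D a - psum x (j a))) / τ) ≤
      (Fintype.card ι) * Real.exp (-m / τ) := by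
    have := Finset.sum_le_card_nsmul (Finset.univ : Finset ι)
      (fun a => Real.exp (-(b a * (D a - psum x (j a))) / τ)) (Real.exp (-m / τ)) (fun a _ => by
        apply Real.exp_le_exp.2
        have := hm a
        gcongr)
    simpa using this
  have hc : (0 : ℝ) < Fintype.card ι := by exact_mod_cast Fintype.card_pos
  have h2 := Real.log_le_log (soft_sum_pos j b D τ x) h1
  rw [Real.log_mul hc.ne' (Real.exp_pos _).ne', Real.log_exp] at h2
  have h3 := mul_le_mul_of_nonneg_left h2 hτ.le
  have h4 : τ * (Real.log (Fintype.card ι) + -m / τ) = τ * Real.log (Fintype.card ι) - m := by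
    field_simp; ring
  linarith

lemma softW_small (hτ : 0 < τ) (a a' : ι) (ε : ℝ) (hε : 0 < ε) (hb : 0 ≤ b a)
    (h : b a' * (D a' - psum x (j a')) + b a * ε ≤ b a * (D a - psum x (j a))) :
    softW j b D τ x a * b a ≤ τ / ε := by
  have h1 : softW j b D τ x a ≤ Real.exp (-(b a * ε) / τ) := by
    unfold softW
    rw [div_le_iff₀ (soft_sum_pos j b D τ x)]
    have h2 : Real.exp (-(b a' * (D a' - psum x (j a'))) / τ) ≤
        ∑ a, Real.exp (-(b a * (D a - psum x (j a))) / τ) :=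
      Finset.single_le_sum (f := fun a => Real.exp (-(b a * (D a - psum x (j a))) / τ))
        (fun _ _ => (Real.exp_pos _).le) (Finset.mem_univ a')
    refine le_trans ?_ (mul_le_mul_of_nonneg_left h2 (Real.exp_pos _).le)
    rw [← Real.exp_add, Real.exp_le_exp, ← add_div]
    gcongr
    linarith
  refine le_trans (mul_le_mul_of_nonneg_right h1 hb) ?_
  rw [le_div_iff₀ hε]
  have h3 := Real.add_one_le_exp (b a * ε / τ)
  have h4 : Real.exp (-(b a * ε) / τ) * Real.exp (b a * ε / τ) = 1 := by
    rw [← Real.exp_add]; simp [neg_div]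
  have h5 : b a * ε = τ * (b a * ε / τ) := by field_simp
  have h6 := Real.exp_pos (-(b a * ε) / τ)
  calc Real.exp (-(b a * ε) / τ) * b a * ε
      = τ * (Real.exp (-(b a * ε) / τ) * (b a * ε / τ)) := by rw [mul_assoc]; nth_rw 2 [h5]; ring
    _ ≤ τ * 1 := by
        refine mul_le_mul_of_nonneg_left ?_ hτ.le
        rw [← h4]
        exact mul_le_mul_of_nonneg_left (by linarith) h6.le
    _ = τ := mul_one _

lemma softF_deriv (hτ : 0 < τ) : HasFDerivAt (softF j b D τ)
    (dotL (fun i : Fin J => - ∑ a, softW j b D τ x a * (if (i : ℕ) < j a then b a else 0))) x := by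
  unfold softF
  have h1 : ∀ a, HasFDerivAt (fun y : Fin J → ℝ => Real.exp (-(b a * (D a - psum y (j a))) / τ))
      ((Real.exp (-(b a * (D a - psum x (j a))) / τ) * (b a / τ)) •
        dotL (fun i : Fin J => if (i : ℕ) < j a then (1 : ℝ) else 0)) x := by
    intro a
    have e1 := (((((hasFDerivAt_psum (j a) x).const_sub (D a)).const_mul (b a)).neg).mul_const
      (τ⁻¹)).exp
    simp only [← div_eq_mul_inv] at e1
    refine e1.congr_fderiv ?_
    ext v
    simp
    ring
  have h2 := ((HasFDerivAt.fun_sum (u := Finset.univ) fun a _ => h1 a).log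
    (soft_sum_pos j b D τ x).ne').const_mul (-τ)
  refine h2.congr_fderiv ?_
  apply ContinuousLinearMap.ext
  intro v
  rw [dotL_apply]
  have e : dotJ (fun i : Fin J => - ∑ a, softW j b D τ x a * (if (i : ℕ) < j a then b a else 0)) v
      = - ∑ a, softW j b D τ x a * b a *
        dotJ (fun i : Fin J => if (i : ℕ) < j a then (1 : ℝ) else 0) v := by
    unfold dotJ
    simp only [neg_mul, Finset.sum_neg_distrib, Finset.sum_mul, Finset.mul_sum]
    rw [Finset.sum_comm]
    congr 1
    refine Finset.sum_congr rfl fun a _ => Finset.sum_congr rfl fun i _ => ?_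
    split_ifs <;> ring
  rw [e]
  simp only [smul_apply, sum_apply, dotL_apply, smul_eq_mul,
    Finset.mul_sum, ← Finset.sum_neg_distrib]
  refine Finset.sum_congr rfl fun a _ => ?_
  unfold softW
  field_simp

end soft

/-- penalty -/
def pen {J : ℕ} [NeZero J] (z : Fin J → ℝ) (M w : ℝ) (x : Fin J → ℝ) : ℝ :=
  ∑ i : Fin J, if i = 0 then 0 else (M / (2 * w)) * (max 0 (x i - z i + w)) ^ 2

lemma pen_nonneg {J : ℕ} [NeZero J] (z : Fin J → ℝ) (M w : ℝ) (hM : 0 ≤ M) (hw : 0 < w)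
    (x : Fin J → ℝ) : 0 ≤ pen z M w x := by
  refine Finset.sum_nonneg fun i _ => ?_
  split_ifs
  · exact le_rfl
  · positivity

lemma pen_le {J : ℕ} [NeZero J] (z : Fin J → ℝ) (M w : ℝ) (hM : 0 ≤ M) (hw : 0 < w)
    (x : Fin J → ℝ) (hx : ∀ i, x i ≤ z i) : pen z M w x ≤ J * (M * w) := by
  have := Finset.sum_le_card_nsmul (Finset.univ : Finset (Fin J))
    (fun i => if i = 0 then 0 else (M / (2 * w)) * (max 0 (x i - z i + w)) ^ 2) (M * w)
    (fun i _ => by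
      split_ifs
      · positivity
      · have h1 : max 0 (x i - z i + w) ≤ w := max_le hw.le (by linarith [hx i])
        have h2 : (max 0 (x i - z i + w)) ^ 2 ≤ w ^ 2 := by gcongr
        calc (M / (2 * w)) * (max 0 (x i - z i + w)) ^ 2 ≤ (M / (2 * w)) * w ^ 2 := by gcongr
          _ = M * w / 2 := by field_simp
          _ ≤ M * w := by have : 0 ≤ M * w := by positivity
                          linarith)
  simpa [pen] using this

lemma pen_deriv {J : ℕ} [NeZero J] (z : Fin J → ℝ) (M w : ℝ) (hw : 0 < w)
    (x : Fin J → ℝ) : HasFDerivAt (pen z M w)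
    (dotL (fun i => if i = 0 then 0 else M / w * max 0 (x i - z i + w))) x := by
  unfold pen
  have h : ∀ i : Fin J, HasFDerivAt (fun y : Fin J → ℝ =>
      if i = 0 then 0 else (M / (2 * w)) * (max 0 (y i - z i + w)) ^ 2)
      ((if i = 0 then 0 else M / w * max 0 (x i - z i + w)) •
        ContinuousLinearMap.proj (R := ℝ) (φ := fun _ : Fin J => ℝ) i) x := by
    intro i
    split_ifs
    · simpa using hasFDerivAt_const (0 : ℝ) x
    · have h1 : HasFDerivAt (fun y : Fin J → ℝ => y i - z i + w)
          (ContinuousLinearMap.proj (R := ℝ) (φ := fun _ : Fin J => ℝ) i) x :=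
        ((ContinuousLinearMap.proj (R := ℝ) (φ := fun _ : Fin J => ℝ) i).hasFDerivAt.sub_const
          (z i)).add_const w
      have h2 := ((hasDerivAt_pos_sq (x i - z i + w)).comp_hasFDerivAt x h1).const_mul (M / (2 * w))
      refine h2.congr_fderiv ?_
      ext v
      simp
      field_simp
  exact HasFDerivAt.fun_sum fun i _ => h i

lemma lin_deriv {J : ℕ} (η : ℝ) (x : Fin J → ℝ) :
    HasFDerivAt (fun y : Fin J → ℝ => η * ∑ l : Fin J, psum y ((l : ℕ) + 1))
      (dotL (fun i : Fin J => η * ((J : ℝ) - (i : ℕ)))) x := by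
  have h := (HasFDerivAt.fun_sum (u := Finset.univ) fun (l : Fin J) _ =>
    hasFDerivAt_psum ((l : ℕ) + 1) x).const_mul η
  refine h.congr_fderiv ?_
  apply ContinuousLinearMap.ext
  intro v
  simp only [smul_apply, sum_apply, dotL_apply, smul_eq_mul]
  unfold dotJ
  rw [Finset.sum_comm, Finset.mul_sum]
  refine Finset.sum_congr rfl fun i _ => ?_
  rw [← Finset.sum_mul, ← mul_assoc]
  congr 2
  rw [Finset.sum_boole]
  have : (Finset.univ.filter fun l : Fin J => (i : ℕ) < l + 1) = Finset.Ici i := by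
    ext l
    simp only [Finset.mem_filter, Finset.mem_univ, true_and, Finset.mem_Ici, Fin.le_def]
    omega
  rw [this, Fin.card_Ici, Nat.cast_sub i.2.le]

/-- offsets -/
def Dd {J : ℕ} (z : Fin J → ℝ) (ε : ℝ) (j k : ℕ) : ℝ :=
  if k ≤ j then psum z j - ((j : ℝ) - k) * ε else psum z k - ((k : ℝ) - j) * ε

lemma Dd_self {J : ℕ} (z : Fin J → ℝ) (ε : ℝ) (k : ℕ) : Dd z ε k k = psum z k := by
  simp [Dd]

lemma Dd_step {J : ℕ} (z : Fin J → ℝ) (ε : ℝ) (l : Fin J) (k : ℕ) (h : 2 * ε ≤ z l) :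
    Dd z ε l k + ε ≤ Dd z ε (l + 1) k ∧ Dd z ε (l + 1) k ≤ Dd z ε l k + z l - ε := by
  unfold Dd
  have h1 := psum_succ z l
  rcases lt_trichotomy k (l + 1) with h2 | h2 | h2
  · rw [if_pos (by omega), if_pos (by omega), h1]
    push_cast
    constructor <;> linarith
  · rw [if_neg (by omega), if_pos (by omega), h2]
    push_cast
    constructor <;> linarith
  · rw [if_neg (by omega), if_neg (by omega)]
    push_cast
    constructor <;> linarith

lemma Dd_ge {J : ℕ} {z : Fin J → ℝ} (hz : ∀ i, 0 ≤ z i) (ε : ℝ) (hε : 0 ≤ ε) (j k : ℕ)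
    (hj : j ≤ J) (hk : k ≤ J) : psum z j - J * ε ≤ Dd z ε j k := by
  unfold Dd
  have hj' : (j : ℝ) ≤ J := by exact_mod_cast hj
  have hk' : (k : ℝ) ≤ J := by exact_mod_cast hk
  have hj0 : (0 : ℝ) ≤ j := by positivity
  have hk0 : (0 : ℝ) ≤ k := by positivity
  split_ifs with h
  · nlinarith
  · have := psum_mono hz (show j ≤ k by omega)
    nlinarith

lemma Dd_ge' {J : ℕ} {z x : Fin J → ℝ} (hx0 : ∀ i, 0 ≤ x i) (hxz : ∀ i, x i ≤ z i)
    (ε : ℝ) (hε : 0 ≤ ε) (j k : ℕ)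
    (hj : j ≤ J) (hk : k ≤ J) : psum z k - psum x k - J * ε ≤ Dd z ε j k - psum x j := by
  unfold Dd
  have hj' : (j : ℝ) ≤ J := by exact_mod_cast hj
  have hk' : (k : ℝ) ≤ J := by exact_mod_cast hk
  have hj0 : (0 : ℝ) ≤ j := by positivity
  have hk0 : (0 : ℝ) ≤ k := by positivity
  split_ifs with h
  · have := psum_diff_mono hxz h
    nlinarith
  · have := psum_mono hx0 (show j ≤ k by omega)
    nlinarith

/-- admissible pairs -/
def okp {J : ℕ} (β : Fin J → ℝ) (j : ℕ) (k : Fin J) : Prop :=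
  ∀ l : Fin J, (l : ℕ) + 1 = j → β k ≤ β l

lemma okp_self {J : ℕ} (β : Fin J → ℝ) (k : Fin J) : okp β (k + 1) k := by
  intro l hl
  have : l = k := Fin.ext (by omega)
  rw [this]

lemma margin_R {J : ℕ} {z x β : Fin J → ℝ} (hz : ∀ i, 0 < z i) (hβ : ∀ i, 0 < β i)
    (hxz : ∀ i, x i ≤ z i) (ε : ℝ) (hε : 0 < ε)
    (hε2 : ∀ i, (J + 1) * ε ≤ z i) (hε3 : ∀ i, 2 * ε ≤ z i) (l k : Fin J) (hx : x l = 0) :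
    ∃ j' : ℕ, ∃ k' : Fin J, j' ≤ J ∧ okp β j' k' ∧
      β k' * (Dd z ε j' (k' + 1) - psum x j') + β k * (ε / 2) ≤
        β k * (Dd z ε (l + 1) (k + 1) - psum x (l + 1)) := by
  have h1 := psum_succ x l
  rw [hx, add_zero] at h1
  have hbk := hβ k
  by_cases h : okp β l k
  · refine ⟨l, k, l.2.le, h, ?_⟩
    have := (Dd_step z ε l (k + 1) (hε3 l)).1
    rw [h1]
    nlinarith
  · simp only [okp, not_forall] at h
    obtain ⟨l', hl', hlt⟩ := h
    push Not at hlt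
    refine ⟨l, l', l.2.le, hl' ▸ okp_self β l', ?_⟩
    rw [hl', Dd_self, h1]
    have h2 := Dd_ge (fun i => (hz i).le) ε hε.le (l + 1) (k + 1) (by omega) (by omega)
    rw [psum_succ z l] at h2
    have h3 := hε2 l
    have h4 := psum_le hxz l
    have h5 : β l' * (psum z l - psum x l) ≤ β k * (psum z l - psum x l) :=
      mul_le_mul_of_nonneg_right hlt.le (by linarith)
    have h6 : β k * (psum z l + ε) ≤ β k * Dd z ε (l + 1) (k + 1) :=
      mul_le_mul_of_nonneg_left (by linarith) hbk.le
    nlinarith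

lemma margin_C {J : ℕ} {z x β : Fin J → ℝ} (hz : ∀ i, 0 < z i) (hβ : ∀ i, 0 < β i)
    (ε ρ : ℝ) (hε : 0 < ε)
    (hε3 : ∀ i, 2 * ε ≤ z i)
    (hε4 : ∀ k l, β l < β k → ε * ((J + 1) * β k) ≤ (β k - β l) * ρ)
    (l k : Fin J) (hρ : ρ ≤ psum z l - psum x l) (hx : z l - ε / 2 ≤ x l) :
    ∃ j' : ℕ, ∃ k' : Fin J, j' ≤ J ∧ okp β j' k' ∧
      β k' * (Dd z ε j' (k' + 1) - psum x j') + β k * (ε / 2) ≤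
        β k * (Dd z ε l (k + 1) - psum x l) := by
  have h1 := psum_succ x l
  have hbk := hβ k
  by_cases h : okp β (l + 1) k
  · refine ⟨l + 1, k, l.2, h, ?_⟩
    have := (Dd_step z ε l (k + 1) (hε3 l)).2
    rw [h1]
    rw [← mul_add]
    apply mul_le_mul_of_nonneg_left _ hbk.le
    linarith
  · simp only [okp, not_forall] at h
    obtain ⟨l', hl', hlt⟩ := h
    push Not at hlt
    have : l' = l := Fin.ext (by omega)
    subst this
    refine ⟨l' + 1, l', l'.2, okp_self β l', ?_⟩
    rw [Dd_self, h1, psum_succ z l']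
    have h2 := Dd_ge (fun i => (hz i).le) ε hε.le l' (k + 1) (by omega) (by omega)
    have h4 := hε4 k l' hlt
    have hbl := hβ l'
    set A := psum z l' - psum x l' with hA
    have h5 : β l' * (psum z l' + z l' - (psum x l' + x l')) ≤ β l' * (A + ε / 2) :=
      mul_le_mul_of_nonneg_left (by linarith) hbl.le
    have h6 : β k * (A - J * ε) ≤ β k * (Dd z ε l' (k + 1) - psum x l') :=
      mul_le_mul_of_nonneg_left (by linarith) hbk.le
    have h7 : (β k - β l') * ρ ≤ (β k - β l') * A :=
      mul_le_mul_of_nonneg_left hρ (by linarith)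
    nlinarith

set_option maxHeartbeats 2000000 in
lemma lower_bound {J : ℕ} [NeZero J] (lam c : ℝ) (μ z β : Fin J → ℝ)
    (hlam : 0 < lam) (hc : 0 < c) (hμ : ∀ i, 0 < μ i) (hz : ∀ i, 0 < z i)
    (hβ : ∀ i, 0 < β i ∧
      c + lam * (1 - Real.exp (β i)) + μ i * (1 - Real.exp (-(β i))) = 0)
    (W : (Fin J → ℝ) → ℝ) (K : ℝ) (hK : 0 ≤ K)
    (hLip : ∀ x ∈ Set.Icc 0 z, ∀ y ∈ Set.Icc 0 z, |W x - W y| ≤ K * ‖x - y‖)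
    (hcont : ContinuousOn W (Set.Icc 0 z))
    (hbd : ∀ x ∈ bdO z, W x = 0)
    (hsub : ∀ x ∈ domG z \ bdC z, ∀ p ∈ subDiff (domG z) W x,
      Ham lam c μ p ≤ 0 ∨ ∃ i : Fin J, x i = 0 ∧ dotJ p (gam J i) ≤ 0)
    (x₀ : Fin J → ℝ) (hx₀ : x₀ ∈ domG z) (V : ℝ)
    (hV : ∀ k : Fin J, V ≤ β k * (psum z ((k : ℕ) + 1) - psum x₀ ((k : ℕ) + 1))) :
    V ≤ W x₀ := by
  by_contra! hcon
  obtain ⟨m, hm, hmV⟩ : ∃ m : ℝ, 0 < m ∧ V - W x₀ = 8 * m :=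
    ⟨(V - W x₀) / 8, by linarith, by ring⟩
  have hβ0 : ∀ i, 0 < β i := fun i => (hβ i).1
  set Bm := ∑ k, β k with hBm
  have hBk : ∀ k, β k ≤ Bm := fun k =>
    Finset.single_le_sum (f := β) (fun i _ => (hβ0 i).le) (Finset.mem_univ k)
  have hBpos : 0 < Bm := lt_of_lt_of_le (hβ0 0) (hBk 0)
  have hμs : 0 < ∑ l, μ l := Finset.sum_pos (fun i _ => hμ i) Finset.univ_nonempty
  have hJ1 : (1 : ℝ) ≤ J := by exact_mod_cast NeZero.one_le
  obtain ⟨ρ, hρ, hρm⟩ : ∃ ρ : ℝ, 0 < ρ ∧ ρ * (K + Bm) = m :=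
    ⟨m / (K + Bm), by positivity, by field_simp⟩
  obtain ⟨δ, ⟨hδ1, hδV⟩, hδ⟩ := (((small_ev 2 1 one_pos).and (small_ev V m hm)).and pos_ev).exists
  have hδc : 0 < δ * c := by positivity
  obtain ⟨η, ⟨⟨hη1, hημ⟩, hηZ⟩, hη⟩ := ((((small_ev 1 1 one_pos).and
    (small_ev (3 * ∑ l, μ l) (δ * c / 2) (by positivity))).and
    (small_ev (J * psum z J) m hm)).and pos_ev).exists
  rw [mul_one] at hη1
  set M := K + J + 1 with hM
  have hM0 : 0 < M := by positivity
  obtain ⟨ε, ⟨⟨⟨⟨hε1, hε2⟩, hε3⟩, hε4⟩, hε5⟩, hε⟩ := (((((((small_ev (J * Bm) m hm).and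
    (small_ev (J * M) m hm)).and
    (eventually_all.2 fun i => small_ev (J + 1) (z i) (hz i))).and
    (eventually_all.2 fun i => small_ev 2 (z i) (hz i))).and
    (eventually_all.2 fun k => eventually_all.2 fun l => eventually_imp_distrib_left.2
      fun h : β l < β k => small_ev ((J + 1) * β k) ((β k - β l) * ρ)
        (mul_pos (by linarith) hρ)))).and pos_ev).exists
  classical
  let ι := {a : Fin (J + 1) × Fin J // okp β (a.1 : ℕ) a.2}
  have mk : ∀ (j' : ℕ) (k' : Fin J), j' ≤ J → okp β j' k' →
      ∃ a : ι, (a.1.1 : ℕ) = j' ∧ a.1.2 = k' := fun j' k' h h' =>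
    ⟨⟨(⟨j', by omega⟩, k'), h'⟩, rfl, rfl⟩
  obtain ⟨a₁, ha₁1, ha₁2⟩ := mk ((0 : Fin J) + 1) 0 (Fin.is_lt _) (okp_self β 0)
  have : Nonempty ι := ⟨a₁⟩
  set N : ℝ := (Fintype.card ι : ℝ) with hN
  have hNpos : 0 < N := by rw [hN]; exact_mod_cast Fintype.card_pos
  obtain ⟨τ, ⟨hτ1, hτ2⟩, hτ⟩ := (((small_ev (Real.log N) m hm).and
    (small_ev (N * 2 / ε) (η / 2) (by positivity))).and pos_ev).exists
  let j : ι → ℕ := fun a => (a.1.1 : ℕ)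
  let b : ι → ℝ := fun a => (1 - δ) * β a.1.2
  let D : ι → ℝ := fun a => Dd z ε (j a) ((a.1.2 : ℕ) + 1)
  have hj : ∀ a, j a ≤ J := fun a => by have := a.1.1.2; simp only [j]; omega
  have hδ' : 0 < 1 - δ := by linarith
  have hb0 : ∀ a, 0 ≤ b a := fun a => (mul_pos hδ' (hβ0 _)).le
  let w := ε / 2
  have hw : 0 < w := by positivity
  let φ : (Fin J → ℝ) → ℝ := fun x => softF j b D τ x - pen z M w x +
    η * ∑ l : Fin J, psum x ((l : ℕ) + 1)
  let p : (Fin J → ℝ) → Fin J → ℝ := fun x i =>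
    - ∑ a, softW j b D τ x a * (if (i : ℕ) < j a then b a else 0) -
    (if i = 0 then 0 else M / w * max 0 (x i - z i + w)) + η * ((J : ℝ) - (i : ℕ))
  have hφd : ∀ x, HasFDerivAt φ (dotL (p x)) x := by
    intro x
    refine (((softF_deriv j b D τ x hτ).sub (pen_deriv z M w hw x)).add
      (lin_deriv η x)).congr_fderiv ?_
    apply ContinuousLinearMap.ext
    intro v
    simp only [add_apply, sub_apply, dotL_apply]
    simp only [dotJ, ← Finset.sum_sub_distrib, ← Finset.sum_add_distrib, p]
    refine Finset.sum_congr rfl fun i _ => ?_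
    ring
  have hφc : Continuous φ := continuous_iff_continuousAt.2 fun x => (hφd x).continuousAt
  obtain ⟨x, hxB, hmin⟩ := isCompact_Icc.exists_isMinOn ⟨x₀, dom_box hx₀⟩
    (hcont.sub hφc.continuousOn)
  have hmin' : ∀ y ∈ Set.Icc 0 z, W x - φ x ≤ W y - φ y := fun y hy => hmin hy
  -- value at x₀
  have hx₀B := dom_box hx₀
  have hv0 : V - 4 * m ≤ φ x₀ := by
    have h1 : V - 2 * m - τ * Real.log N ≤ softF j b D τ x₀ := by
      apply le_softF _ _ _ _ _ hτ
      intro a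
      have h2 := Dd_ge' hx₀B.1 hx₀B.2 ε hε.le (j a) ((a.1.2 : ℕ) + 1) (hj a) (by omega)
      have h3 := hV a.1.2
      have h4 := hBk a.1.2
      have h5 : β a.1.2 * (psum z ((a.1.2 : ℕ) + 1) - psum x₀ ((a.1.2 : ℕ) + 1) - J * ε) ≤
        β a.1.2 * (D a - psum x₀ (j a)) := mul_le_mul_of_nonneg_left h2 (hβ0 _).le
      have h6 : β a.1.2 * (J * ε) ≤ Bm * (J * ε) := mul_le_mul_of_nonneg_right h4 (by positivity)
      have h7 : V - m ≤ β a.1.2 * (D a - psum x₀ (j a)) := by nlinarith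
      have h8 := mul_le_mul_of_nonneg_left h7 hδ'.le
      simp only [b]
      have h9 : 0 ≤ δ * m := by positivity
      nlinarith
    have h2 := pen_le z M w hM0.le hw x₀ hx₀B.2
    have h3 : 0 ≤ η * ∑ l : Fin J, psum x₀ ((l : ℕ) + 1) := by
      refine mul_nonneg hη.le (Finset.sum_nonneg fun l _ => ?_)
      have := psum_mono hx₀B.1 (Nat.zero_le ((l : ℕ) + 1))
      rwa [psum_zero] at this
    have h4 : (J : ℝ) * (M * w) ≤ m := by
      simp only [w]
      nlinarith
    simp only [φ]
    linarith
  have hρx : ρ ≤ z 0 - x 0 := by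
    have h1 : φ x ≤ Bm * (z 0 - x 0) + m := by
      have h2 := softF_le j b D τ x hτ a₁
      have h3 := pen_nonneg z M w hM0.le hw x
      have h4 : η * ∑ l : Fin J, psum x ((l : ℕ) + 1) ≤ m := by
        refine le_trans ?_ hηZ
        refine mul_le_mul_of_nonneg_left ?_ hη.le
        have := Finset.sum_le_card_nsmul (Finset.univ : Finset (Fin J))
          (fun l => psum x ((l : ℕ) + 1)) (psum z J) (fun l _ =>
            (psum_le hxB.2 _).trans (psum_le_total (fun i => (hz i).le) _))
        simpa using this
      have h5 : b a₁ * (D a₁ - psum x (j a₁)) ≤ Bm * (z 0 - x 0) := by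
        simp only [b, D, j, ha₁1, ha₁2]
        rw [Dd_self]
        simp only [Fin.val_zero, zero_add, psum_one]
        have h6 := hBk 0
        have h7 := hβ0 0
        refine mul_le_mul_of_nonneg_right ?_ (by linarith [hxB.2 0])
        have h8 : 0 ≤ δ * β 0 := by positivity
        linarith
      simp only [φ]
      linarith
    have h2 : -(K * (z 0 - x 0)) ≤ W x := by
      have hyO : Function.update x 0 (z 0) ∈ bdO z := by
        refine ⟨by simp, fun i hi => ?_⟩
        rw [Function.update_of_ne hi]
        exact ⟨hxB.1 i, hxB.2 i⟩
      have hyB : Function.update x 0 (z 0) ∈ Set.Icc 0 z := by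
        refine ⟨fun i => ?_, fun i => ?_⟩ <;> by_cases hi : i = 0
        · subst hi; simp [(hz 0).le]
        · rw [Function.update_of_ne hi]; exact hxB.1 i
        · subst hi; simp
        · rw [Function.update_of_ne hi]; exact hxB.2 i
      have h3 := hLip x hxB _ hyB
      rw [hbd _ hyO] at h3
      have h4 : ‖x - Function.update x 0 (z 0)‖ ≤ z 0 - x 0 := by
        rw [pi_norm_le_iff_of_nonneg (by linarith [hxB.2 0])]
        intro i
        by_cases hi : i = 0
        · subst hi
          simp only [Pi.sub_apply, Function.update_self, Real.norm_eq_abs]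
          rw [abs_sub_comm, abs_of_nonneg (by linarith [hxB.2 0])]
        · simp only [Pi.sub_apply, Function.update_of_ne hi]; simpa using hxB.2 0
      have h5 := mul_le_mul_of_nonneg_left h4 hK
      have := (abs_le.1 h3).1
      linarith
    have h3 := hmin' x₀ hx₀B
    have h4 : ρ * (K + Bm) ≤ (z 0 - x 0) * (K + Bm) := by linarith
    exact le_of_mul_le_mul_right h4 (by positivity)
  have hxG : x ∈ domG z := ⟨hxB.1, by linarith, fun i _ => hxB.2 i⟩
  have hps : p x ∈ subDiff (domG z) W x :=
    sub_of_min _ W φ x (p x) (hφd x) fun y hy => hmin' y (dom_box hy)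
  -- the weights
  let ν := softW j b D τ x
  have hν0 : ∀ a, 0 ≤ ν a := fun a => softW_nonneg j b D τ x a
  have hν1 : ∑ a, ν a = 1 := softW_sum j b D τ x
  let θ : ℕ → ℝ := fun n => if h : n < J ∧ n ≠ 0 then
    M / w * max 0 (x ⟨n, h.1⟩ - z ⟨n, h.1⟩ + w) else 0
  have hθ : ∀ n, 0 ≤ θ n := fun n => by
    simp only [θ]; split_ifs
    · positivity
    · exact le_rfl
  have hθ0 : θ 0 = 0 := by simp [θ]
  have hθJ : θ J = 0 := by simp [θ]
  have hθi : ∀ i : Fin J, θ i = if i = 0 then 0 else M / w * max 0 (x i - z i + w) := by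
    intro i
    simp only [θ]
    by_cases hi : i = 0
    · subst hi; simp
    · have : (i : ℕ) ≠ 0 := fun h => hi (Fin.ext (by simpa using h))
      rw [dif_pos ⟨i.2, this⟩, if_neg hi]
  have hsmall : ∀ l : Fin J, (∀ k : Fin J, ∃ j' : ℕ, ∃ k' : Fin J, j' ≤ J ∧ okp β j' k' ∧
      β k' * (Dd z ε j' (k' + 1) - psum x j') + β k * (ε / 2) ≤
        β k * (Dd z ε (l + 1) (k + 1) - psum x (l + 1))) →
      ∑ a, ν a * (if j a = l + 1 then b a else 0) ≤ η / 2 := by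
    intro l hl
    have h1 : ∀ a ∈ (Finset.univ : Finset ι), ν a * (if j a = l + 1 then b a else 0) ≤ τ / (ε / 2) := by
      intro a _
      split_ifs with hja
      · obtain ⟨j', k', hj', hk', hle⟩ := hl a.1.2
        obtain ⟨a', hna1, hna2⟩ := mk j' k' hj' hk'
        apply softW_small j b D τ x hτ a a' (ε / 2) (by positivity) (hb0 a)
        simp only [D, b, hja]
        simp only [j, hna1, hna2]
        have := mul_le_mul_of_nonneg_left hle hδ'.le
        nlinarith
      · rw [mul_zero]; positivity
    have h2 := Finset.sum_le_card_nsmul _ _ _ h1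
    refine h2.trans ?_
    rw [nsmul_eq_mul, Finset.card_univ]
    refine le_trans (le_of_eq ?_) hτ2
    rw [← hN]
    field_simp
  have hε3' : ∀ i, (J + 1) * ε ≤ z i := fun i => by have := hε3 i; linarith
  have hε4' : ∀ i, 2 * ε ≤ z i := fun i => by have := hε4 i; linarith
  obtain ⟨hPJ, hPd, hHam⟩ := ham_pos lam c μ hlam hμ j hj b ν hb0 hν0 hν1 θ hθ hθ0 hθJ η δ hη hη1
    (by
      intro a
      rcases Nat.eq_zero_or_pos (j a) with h0 | h0
      · simp only [h0]
        simp
        nlinarith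
      · rw [if_pos h0]
        have hlt : j a - 1 < J := by have := hj a; omega
        rw [Finset.sum_eq_single (⟨j a - 1, hlt⟩ : Fin J)]
        · rw [if_pos (by simp only []; omega)]
          apply f_low lam c _ (β ⟨j a - 1, hlt⟩) (b a) δ hlam hc (hμ _) (hβ0 _) (hb0 a) _ hδ.le
            (hβ _).2
          refine mul_le_mul_of_nonneg_left ?_ hδ'.le
          apply a.2
          simp only [j] at h0 ⊢
          omega
        · intro l _ hl
          rw [if_neg]
          · simp
          · intro h; apply hl; apply Fin.ext; simp only []; omega
        · simp)
    (by
      intro l hl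
      apply hsmall
      intro k
      simp only [θ] at hl
      split_ifs at hl with h
      · have hpos : 0 < max 0 (x ⟨l + 1, h.1⟩ - z ⟨l + 1, h.1⟩ + w) :=
          (pos_iff_pos_of_mul_pos hl).1 (by positivity)
        have hpos' : 0 < x ⟨l + 1, h.1⟩ - z ⟨l + 1, h.1⟩ + w := by
          rcases lt_max_iff.1 hpos with h' | h'
          · exact absurd h' (lt_irrefl _)
          · exact h'
        refine margin_C hz hβ0 ε ρ hε hε4' hε5 ⟨l + 1, h.1⟩ k ?_ ?_
        · have := psum_diff_mono hxB.2 (show 1 ≤ (l : ℕ) + 1 by omega)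
          rw [psum_one, psum_one] at this
          simp only []
          linarith
        · simp only [w] at hpos'
          linarith
      · exact absurd hl (lt_irrefl _))
    (by linarith)
    (fun n => - ∑ a, ν a * (if n < j a then b a else 0) - θ n + η * (J - n)) (fun n => rfl)
  have hpP : p x = fun i : Fin J =>
      (fun n : ℕ => - ∑ a, ν a * (if n < j a then b a else 0) - θ n + η * (J - n)) i := by
    funext i
    simp only [p, hθi, ν]
  -- not on the constrained boundary
  have hxC : x ∉ bdC z := by
    rintro ⟨-, i, hi, hxi⟩
    obtain ⟨r, hr, h⟩ := hps (1 / 2) (by norm_num)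
    obtain ⟨t, ⟨ht1, ht2⟩, ht⟩ := (((small_ev 2 r hr).and (small_ev 1 (z i) (hz i))).and
      pos_ev).exists
    have hn : ‖Function.update x i (x i - t) - x‖ = t := by
      have e : Function.update x i (x i - t) - x = Pi.single i (-t) := by
        funext l
        by_cases hl : l = i
        · subst hl; simp
        · simp [Function.update_of_ne hl, Pi.single_eq_of_ne hl]
      rw [e, Pi.norm_single, norm_neg, Real.norm_eq_abs, abs_of_pos ht]
    have hd : dotJ (p x) (Function.update x i (x i - t) - x) = - (t * p x i) := by
      have e : Function.update x i (x i - t) - x = Pi.single i (-t) := by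
        funext l
        by_cases hl : l = i
        · subst hl; simp
        · simp [Function.update_of_ne hl, Pi.single_eq_of_ne hl]
      rw [e]
      unfold dotJ
      rw [Finset.sum_eq_single i]
      · simp; ring
      · intro l _ hl; simp [Pi.single_eq_of_ne hl]
      · simp
    have hyG : Function.update x i (x i - t) ∈ domG z := by
      refine ⟨fun l => ?_, ?_, fun l hl' => ?_⟩
      · by_cases hl : l = i
        · subst hl; simp; linarith
        · rw [Function.update_of_ne hl]; exact hxB.1 l
      · rw [Function.update_of_ne (Ne.symm hi)]; linarith
      · by_cases hl : l = i
        · subst hl; simp; linarith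
        · rw [Function.update_of_ne hl]; exact hxB.2 l
    have h1 := h _ hyG (by rw [hn]; linarith)
    have h2 := hLip _ (dom_box hyG) x hxB
    rw [hn] at h1 h2
    rw [hd] at h1
    have h3 := (abs_le.1 h2).2
    have h4 : p x i ≤ - M + J := by
      simp only [p]
      rw [if_neg hi, hxi]
      have e1 : 0 ≤ ∑ a, softW j b D τ x a * (if (i : ℕ) < j a then b a else 0) :=
        Finset.sum_nonneg fun a _ => mul_nonneg (hν0 a) (by
          have := hb0 a
          split_ifs <;> simp [this])
      have e2 : M / w * max 0 (z i - z i + w) = M := by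
        rw [sub_self, zero_add, max_eq_right hw.le]; field_simp
      rw [e2]
      have e3 : (0 : ℝ) ≤ (i : ℕ) := by positivity
      nlinarith
    have h5 : t * p x i ≤ t * (- M + J) := mul_le_mul_of_nonneg_left h4 ht.le
    rw [hM] at h5
    nlinarith
  rcases hsub x ⟨hxG, hxC⟩ (p x) hps with h | ⟨l, hl0, hl⟩
  · rw [hpP] at h
    linarith
  · have hg := (dot_gam (fun n : ℕ =>
      - ∑ a, ν a * (if n < j a then b a else 0) - θ n + η * (J - n)) hPJ l).trans (hPd l)
    rw [dotJ_comm, hpP] at hl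
    replace hl := hg.symm.le.trans hl
    have h1 := hsmall l fun k => margin_R hz hβ0 hxB.2 ε hε hε3' hε4' l k hl0
    have h2 : θ l = 0 := by
      rw [hθi]
      split_ifs with h
      · rfl
      · rw [hl0, max_eq_left, mul_zero]
        have := hε4' l
        simp only [w]
        linarith
    have h3 := hθ (l + 1)
    rw [h2] at hl
    linarith

/-- uniqueness — any Lipschitz viscosity solution `W` of the PDE coincides with
`min_i b_i·(z−x)` on `G`. -/
theorem stmt1 (J : ℕ) [NeZero J] (lam c : ℝ) (μ z β : Fin J → ℝ)
    (hlam : 0 < lam) (hc : 0 < c) (hμ : ∀ i, 0 < μ i) (hz : ∀ i, 0 < z i)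
    (hβ : ∀ i, 0 < β i ∧
      c + lam * (1 - Real.exp (β i)) + μ i * (1 - Real.exp (-(β i))) = 0)
    (W : (Fin J → ℝ) → ℝ)
    (hLip : ∃ K : NNReal, LipschitzOnWith K W (closure (domG z)))
    (hbd : ∀ x ∈ bdO z, W x = 0)
    (hsup : ∀ x ∈ domG z, ∀ p ∈ supDiff (domG z) W x,
      0 ≤ Ham lam c μ p ∨ ∃ i : Fin J, x i = 0 ∧ 0 ≤ dotJ p (gam J i))
    (hsub : ∀ x ∈ domG z \ bdC z, ∀ p ∈ subDiff (domG z) W x,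
      Ham lam c μ p ≤ 0 ∨ ∃ i : Fin J, x i = 0 ∧ dotJ p (gam J i) ≤ 0) :
    ∀ x ∈ domG z, W x = ⨅ i, dotJ (bvec β i) (z - x) := by
  obtain ⟨K, hK⟩ := hLip
  have hK' := hK.mono (box_closure hz)
  have hcont := hK'.continuousOn
  intro x hx
  have hne : Nonempty (Fin J) := ⟨0⟩
  apply le_antisymm
  · refine le_ciInf fun k => ?_
    rw [dot_bvec]
    exact upper_bound lam c μ z β hlam hc hμ hz hβ W hcont hbd hsup x hx k
  · refine lower_bound lam c μ z β hlam hc hμ hz hβ W K K.2 ?_ hcont hbd hsub x hx _ fun k => ?_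
    · intro u hu v hv
      have := hK'.dist_le_mul u hu v hv
      rwa [Real.dist_eq, dist_eq_norm] at this
    · rw [← dot_bvec]
      exact ciInf_le (Set.finite_range _).bddBelow k
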